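/- arXiv:1708.06090 — 4 statements merged into one kernel-verified Lean document; each statement's English description precedes it below -/
import Mathlib

section
/- Let (A, m) be a two-dimensional regular local ring with infinite residue field and I an m-primary ideal. Then I has the strong Rees property if and only if I = m^n for some n ≥ 1. -/
open IsLocalRing

/-- `mu I` is the minimal number of generators of the ideal `I`. -/
noncomputable def mu {A : Type*} [CommRing A] (I : Ideal A) : ℕ :=
  sInf {n | ∃ s : Finset A, s.card = n ∧ Ideal.span (s : Set A) = I}

section Helpers

variable {A : Type*} [CommRing A]

lemma pow_pair_le (x y : A) (n : ℕ) :
    Ideal.span {x, y} ^ n ≤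
      Ideal.span (Set.range fun i : Fin (n + 1) => x ^ (i : ℕ) * y ^ (n - (i : ℕ))) := by
  induction n with
  | zero =>
    have : (1 : A) ∈ Ideal.span
        (Set.range fun i : Fin (0 + 1) => x ^ (i : ℕ) * y ^ (0 - (i : ℕ))) :=
      Ideal.subset_span ⟨0, by simp⟩
    rw [(Ideal.eq_top_iff_one _).mpr this]
    exact le_top
  | succ n ih =>
    rw [pow_succ]
    refine (Ideal.mul_mono_left ih).trans ?_
    rw [Ideal.span_mul_span', Ideal.span_le]
    rintro _ ⟨_, ⟨i, rfl⟩, z, hz, rfl⟩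
    have hi : (i : ℕ) ≤ n := by omega
    rcases hz with rfl | hz
    · refine Ideal.subset_span ⟨i.succ, ?_⟩
      have h1 : n + 1 - ((i : ℕ) + 1) = n - i := by omega
      simp only [Fin.val_succ, h1]
      ring
    · rw [Set.mem_singleton_iff] at hz
      subst hz
      refine Ideal.subset_span ⟨i.castSucc, ?_⟩
      have h1 : n + 1 - (i : ℕ) = n - i + 1 := by omega
      simp only [Fin.val_castSucc, h1]
      ring

lemma pow_pair_le' (x y : A) (n : ℕ) :
    Ideal.span {x, y} ^ n ≤ Ideal.span {x, y ^ n} := by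
  refine (pow_pair_le x y n).trans ?_
  rw [Ideal.span_le]
  rintro _ ⟨i, rfl⟩
  rcases Nat.eq_zero_or_pos (i : ℕ) with h | h
  · apply Ideal.subset_span
    simp [h]
  · obtain ⟨j, hj⟩ := Nat.exists_eq_add_of_lt h
    simp only [hj, zero_add, pow_succ]
    have hx : x ∈ Ideal.span {x, y ^ n} := Ideal.subset_span (by simp)
    exact Ideal.mul_mem_right _ _ (Ideal.mul_mem_left _ _ hx)

lemma key [IsLocalRing A] [Infinite (ResidueField A)] (x y : A) (n : ℕ)
    (hm : maximalIdeal A = Ideal.span {x, y}) (a : Fin (n + 1) → A) (i₀ : Fin (n + 1))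
    (h₀ : a i₀ ∉ maximalIdeal A) :
    ∃ x' : A, maximalIdeal A = Ideal.span {x', y} ∧
      y ^ n ∈ Ideal.span {x', ∑ i, a i * (x ^ (i : ℕ) * y ^ (n - (i : ℕ)))} := by
  classical
  let P : Polynomial (ResidueField A) :=
    ∑ i : Fin (n + 1), Polynomial.C (residue A (a i)) * Polynomial.X ^ (i : ℕ)
  have hP : P ≠ 0 := by
    intro h
    have h2 : P.coeff i₀ = residue A (a i₀) := by
      simp only [P, Polynomial.finsetSum_coeff, Polynomial.coeff_C_mul_X_pow, Fin.val_inj]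
      simp
    rw [h, Polynomial.coeff_zero] at h2
    exact h₀ ((residue_eq_zero_iff _).mp h2.symm)
  obtain ⟨cbar, hcbar⟩ : ∃ c, P.eval c ≠ 0 := by
    by_contra! h
    exact hP (Polynomial.zero_of_eval_zero _ h)
  obtain ⟨c, rfl⟩ := residue_surjective cbar
  have hu : IsUnit (∑ i, a i * c ^ (i : ℕ)) := by
    rw [← residue_ne_zero_iff_isUnit]
    simpa [P, Polynomial.eval_finsetSum] using hcbar
  refine ⟨x - c * y, ?_, ?_⟩
  · rw [hm]
    apply le_antisymm <;> rw [Ideal.span_le] <;> rintro z (rfl | hz)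
    · exact Ideal.mem_span_pair.mpr ⟨1, c, by ring⟩
    · rw [Set.mem_singleton_iff] at hz
      subst hz
      exact Ideal.mem_span_pair.mpr ⟨0, 1, by ring⟩
    · exact Ideal.mem_span_pair.mpr ⟨1, -c, by ring⟩
    · rw [Set.mem_singleton_iff] at hz
      subst hz
      exact Ideal.mem_span_pair.mpr ⟨0, 1, by ring⟩
  · have hd : x - c * y ∣ ∑ i, a i * (x ^ (i : ℕ) * y ^ (n - (i : ℕ)))
        - (∑ i, a i * c ^ (i : ℕ)) * y ^ n := by
      rw [Finset.sum_mul, ← Finset.sum_sub_distrib]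
      refine Finset.dvd_sum fun i _ => ?_
      have hi : y ^ n = y ^ (i : ℕ) * y ^ (n - (i : ℕ)) := by
        rw [← pow_add]; congr 1; omega
      have : a i * (x ^ (i : ℕ) * y ^ (n - (i : ℕ))) - a i * c ^ (i : ℕ) * y ^ n
          = (x ^ (i : ℕ) - (c * y) ^ (i : ℕ)) * (a i * y ^ (n - (i : ℕ))) := by
        rw [hi, mul_pow]; ring
      rw [this]
      exact (sub_dvd_pow_sub_pow _ _ _).mul_right _
    obtain ⟨d, hd⟩ := hd
    obtain ⟨v, hv⟩ := hu.exists_left_inv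
    refine Ideal.mem_span_pair.mpr ⟨-(v * d), v, ?_⟩
    linear_combination v * hd + y ^ n * hv

lemma exists_span_of_length {M : Type*} [AddCommGroup M] [Module A M] (r : ℕ)
    (h : Module.length A M ≤ r) :
    ∃ s : Fin r → M, Submodule.span A (Set.range s) = ⊤ := by
  classical
  induction r generalizing M with
  | zero =>
    have h0 : Module.length A M = 0 := by simpa using h
    have := Module.length_eq_zero_iff.mp h0
    exact ⟨fun _ => 0, Subsingleton.elim _ _⟩
  | succ r ih =>
    rcases subsingleton_or_nontrivial M with hs | hs
    · exact ⟨fun _ => 0, Subsingleton.elim _ _⟩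
    obtain ⟨v, hv⟩ := exists_ne (0 : M)
    let N := Submodule.span A {v}
    have hadd := Module.length_eq_add_of_exact N.subtype N.mkQ N.subtype_injective
      N.mkQ_surjective (LinearMap.exact_subtype_mkQ N)
    have hN : 1 ≤ Module.length A N := by
      rw [Order.one_le_iff_pos, Module.length_pos_iff, Submodule.nontrivial_iff_ne_bot]
      simpa [N] using hv
    have hq : Module.length A (M ⧸ N) ≤ r := by
      rw [hadd] at h
      have h2 : (1 : ℕ∞) + Module.length A (M ⧸ N) ≤ 1 + r :=
        (add_le_add_left hN _).trans (h.trans (by rw [add_comm]; push_cast; rfl))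
      exact (ENat.add_le_add_iff_left (by simp)).mp h2
    obtain ⟨s, hs⟩ := ih hq
    choose t ht using fun i => N.mkQ_surjective (s i)
    refine ⟨Fin.cons v t, ?_⟩
    rw [Fin.range_cons, Submodule.span_insert]
    have : Submodule.map N.mkQ (Submodule.span A (Set.range t)) = ⊤ := by
      rw [Submodule.map_span, ← Set.range_comp]
      have hts : (fun i => N.mkQ (t i)) = s := funext ht
      rw [← hs, ← hts]
      rfl
    have h3 := congrArg (Submodule.comap N.mkQ) this
    rwa [Submodule.comap_map_mkQ, Submodule.comap_top] at h3

lemma length_quot_le [IsLocalRing A] (x y : A) (hm : maximalIdeal A = Ideal.span {x, y}) (s : ℕ) :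
    Module.length A (A ⧸ Ideal.span {x, y ^ s}) ≤ s := by
  induction s with
  | zero =>
    have : Ideal.span {x, y ^ 0} = ⊤ := by
      rw [Ideal.eq_top_iff_one]; exact Ideal.subset_span (by simp)
    rw [this]
    have : Subsingleton (A ⧸ (⊤ : Ideal A)) := Submodule.Quotient.subsingleton_iff.mpr rfl
    simp
  | succ s ih =>
    set K := Ideal.span {x, y ^ (s + 1)} with hK
    set L := Ideal.span {x, y ^ s} with hL
    have hxK : x ∈ K := Ideal.subset_span (by simp)
    have hyK : y ^ (s + 1) ∈ K := Ideal.subset_span (by simp)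
    have hxL : x ∈ L := Ideal.subset_span (by simp)
    have hyL : y ^ s ∈ L := Ideal.subset_span (by simp)
    have hKL : K ≤ L := by
      rw [hK, Ideal.span_le]
      rintro z (rfl | hz)
      · exact hxL
      · rw [Set.mem_singleton_iff] at hz
        rw [hz, pow_succ]
        exact Ideal.mul_mem_right _ _ hyL
    let g : (A ⧸ K) →ₗ[A] (A ⧸ L) := Submodule.factor hKL
    have hg : Function.Surjective g := Submodule.factor_surjective hKL
    have hadd := Module.length_eq_add_of_exact (LinearMap.ker g).subtype g
      (Submodule.subtype_injective _) hg (LinearMap.exact_subtype_ker_map g)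
    let φ : A →ₗ[A] (A ⧸ K) := LinearMap.toSpanSingleton A _ (Submodule.Quotient.mk (y ^ s))
    have hφ : maximalIdeal A ≤ LinearMap.ker φ := by
      rw [hm, Ideal.span_le]
      have aux : ∀ z, z * y ^ s ∈ K → z ∈ (LinearMap.ker φ : Set A) := by
        intro z hz
        change φ z = 0
        rw [LinearMap.toSpanSingleton_apply, ← Submodule.Quotient.mk_smul,
          Submodule.Quotient.mk_eq_zero]
        exact hz
      rintro z (rfl | hz)
      · exact aux _ (Ideal.mul_mem_right _ _ hxK)
      · rw [Set.mem_singleton_iff] at hz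
        subst hz
        refine aux _ ?_
        rw [← pow_succ']
        exact hyK
    let ψ : (A ⧸ maximalIdeal A) →ₗ[A] (A ⧸ K) := Submodule.liftQ _ φ hφ
    have hker : LinearMap.ker g ≤ LinearMap.range ψ := by
      intro z hz
      obtain ⟨w, rfl⟩ := Submodule.Quotient.mk_surjective _ z
      have hw : w ∈ L := by
        rw [← Submodule.Quotient.mk_eq_zero L]; exact hz
      obtain ⟨b, c, rfl⟩ := Ideal.mem_span_pair.mp hw
      refine ⟨Submodule.Quotient.mk c, ?_⟩
      change φ c = _
      rw [LinearMap.toSpanSingleton_apply, ← Submodule.Quotient.mk_smul, eq_comm,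
        Submodule.Quotient.eq]
      have : b * x + c * y ^ s - c • y ^ s = b * x := by simp
      rw [this]
      exact Ideal.mul_mem_left _ _ hxK
    have h1 : Module.length A (LinearMap.ker g) ≤ 1 := by
      refine (Module.length_le_of_injective (Submodule.inclusion hker)
        (Submodule.inclusion_injective _)).trans ?_
      refine (Module.length_le_of_surjective ψ.rangeRestrict ψ.surjective_rangeRestrict).trans ?_
      have : IsSimpleModule A (A ⧸ maximalIdeal A) :=
        isSimpleModule_iff_isCoatom.mpr (maximalIdeal.isMaximal A).out
      rw [Module.length_eq_one]
    rw [hadd, add_comm]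
    push_cast
    exact add_le_add ih h1

lemma length_ne_top_of_pow_le [IsNoetherianRing A] [IsLocalRing A] (I : Ideal A) (k : ℕ)
    (hk : maximalIdeal A ^ k ≤ I) : Module.length A (A ⧸ I) ≠ ⊤ := by
  rcases subsingleton_or_nontrivial (A ⧸ I) with hs | hs
  · simp
  have hloc : IsLocalRing (A ⧸ I) :=
    IsLocalRing.of_surjective' (Ideal.Quotient.mk I) Ideal.Quotient.mk_surjective
  have hart : IsArtinianRing (A ⧸ I) := by
    rw [isArtinianRing_iff_isNilpotent_maximalIdeal]
    refine ⟨k, ?_⟩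
    have hmap : maximalIdeal (A ⧸ I) ≤ (maximalIdeal A).map (Ideal.Quotient.mk I) := by
      intro z hz
      obtain ⟨w, rfl⟩ := Ideal.Quotient.mk_surjective z
      refine Ideal.mem_map_of_mem _ ?_
      rw [mem_maximalIdeal, mem_nonunits_iff] at hz ⊢
      exact fun h => hz (h.map _)
    rw [Ideal.zero_eq_bot, eq_bot_iff]
    refine (Ideal.pow_right_mono hmap k).trans ?_
    rw [← Ideal.map_pow, Ideal.map_le_iff_le_comap, ← RingHom.ker_eq_comap_bot, Ideal.mk_ker]
    exact hk
  have : IsArtinian A (A ⧸ I) :=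
    isArtinian_of_surjective_algebraMap (R := A ⧸ I) (S := A) Ideal.Quotient.mk_surjective
  exact Module.length_ne_top

lemma mu_le {ι : Type*} [Fintype ι] (I : Ideal A) (g : ι → A)
    (h : Ideal.span (Set.range g) = I) : mu I ≤ Fintype.card ι := by
  classical
  have h1 : mu I ≤ (Finset.univ.image g).card :=
    Nat.sInf_le ⟨Finset.univ.image g, rfl, by simpa using h⟩
  exact h1.trans Finset.card_image_le

lemma mu_spec [IsNoetherianRing A] (I : Ideal A) :
    ∃ s : Finset A, s.card = mu I ∧ Ideal.span (s : Set A) = I := by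
  have : mu I ∈ {n | ∃ s : Finset A, s.card = n ∧ Ideal.span (s : Set A) = I} := by
    apply Nat.sInf_mem
    obtain ⟨s, hs⟩ := IsNoetherian.noetherian I
    exact ⟨_, s, rfl, hs⟩
  exact this

/-- `μ(I) ≤ ord(I) + 1`. -/
lemma mu_le_ord [IsNoetherianRing A] [IsLocalRing A] [Infinite (ResidueField A)]
    (hreg : ∃ x y : A, maximalIdeal A = Ideal.span {x, y})
    (I : Ideal A) (k : ℕ) (hk : maximalIdeal A ^ k ≤ I) (r : ℕ)
    (h1 : I ≤ maximalIdeal A ^ r) (h2 : ¬ I ≤ maximalIdeal A ^ (r + 1)) : mu I ≤ r + 1 := by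
  obtain ⟨x₀, y, hm₀⟩ := hreg
  obtain ⟨f, hfI, hf⟩ := Set.not_subset.mp h2
  have hfr := pow_pair_le x₀ y r (hm₀ ▸ h1 hfI)
  obtain ⟨a, ha⟩ := Ideal.mem_span_range_iff_exists_fun.mp hfr
  obtain ⟨i₀, hi₀⟩ : ∃ i, a i ∉ maximalIdeal A := by
    by_contra! hall
    apply hf
    rw [← ha, SetLike.mem_coe, pow_succ']
    refine Ideal.sum_mem _ fun i _ => Ideal.mul_mem_mul (hall i) ?_
    have hx : x₀ ∈ maximalIdeal A := hm₀ ▸ Ideal.subset_span (by simp)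
    have hy : y ∈ maximalIdeal A := hm₀ ▸ Ideal.subset_span (by simp)
    have : r = (i : ℕ) + (r - (i : ℕ)) := by omega
    have hmem := Ideal.mul_mem_mul (Ideal.pow_mem_pow hx (i : ℕ))
      (Ideal.pow_mem_pow hy (r - (i : ℕ)))
    rwa [← pow_add, ← this] at hmem
  obtain ⟨x, hm, hy⟩ := key x₀ y r hm₀ a i₀ hi₀
  rw [ha] at hy
  have hxm : x ∈ maximalIdeal A := hm ▸ Ideal.subset_span (by simp)
  -- I ≤ (x, f)
  have hIxf : I ≤ Ideal.span {x, f} := by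
    refine h1.trans ?_
    rw [hm]
    refine (pow_pair_le' x y r).trans ?_
    rw [Ideal.span_le]
    rintro z (rfl | hz)
    · exact Ideal.subset_span (by simp)
    · rw [Set.mem_singleton_iff] at hz
      subst hz
      exact hy
  -- multiplication by x on A / I
  let φ : (A ⧸ I) →ₗ[A] (A ⧸ I) := LinearMap.lsmul A (A ⧸ I) x
  have e1 := Module.length_eq_add_of_exact (LinearMap.ker φ).subtype φ.rangeRestrict
    (Submodule.subtype_injective _) φ.surjective_rangeRestrict
    (by
      intro z
      rw [Submodule.coe_subtype, Subtype.range_coe, SetLike.mem_coe, LinearMap.mem_ker]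
      rw [← Subtype.coe_inj]; rfl)
  have e2 := Module.length_eq_add_of_exact (LinearMap.range φ).subtype (LinearMap.range φ).mkQ
    (Submodule.subtype_injective _) (Submodule.mkQ_surjective _)
    (LinearMap.exact_subtype_mkQ _)
  have hfin := length_ne_top_of_pow_le I k hk
  have hker : Module.length A (LinearMap.ker φ) = Module.length A ((A ⧸ I) ⧸ LinearMap.range φ) := by
    have hr : Module.length A (LinearMap.range φ) ≠ ⊤ := by
      intro h
      rw [h] at e1
      exact hfin (by simpa using e1)
    rw [e1, add_comm] at e2
    exact ENat.add_right_injective_of_ne_top hr e2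
  have hcok : Module.length A ((A ⧸ I) ⧸ LinearMap.range φ) ≤ r := by
    have hle : Ideal.span {x, y ^ r} ≤
        LinearMap.ker ((LinearMap.range φ).mkQ ∘ₗ (Submodule.mkQ I)) := by
      have hxk : x ∈ LinearMap.ker ((LinearMap.range φ).mkQ ∘ₗ (Submodule.mkQ I)) := by
        rw [LinearMap.mem_ker, LinearMap.comp_apply, Submodule.mkQ_apply,
          Submodule.Quotient.mk_eq_zero]
        refine ⟨Submodule.Quotient.mk 1, ?_⟩
        change x • (Submodule.Quotient.mk 1 : A ⧸ I) = _
        rw [← Submodule.Quotient.mk_smul]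
        simp
      have hfk : f ∈ LinearMap.ker ((LinearMap.range φ).mkQ ∘ₗ (Submodule.mkQ I)) := by
        rw [LinearMap.mem_ker, LinearMap.comp_apply]
        have : Submodule.mkQ I f = 0 := by
          rw [Submodule.mkQ_apply, Submodule.Quotient.mk_eq_zero]; exact hfI
        rw [this, map_zero]
      rw [Ideal.span_le]
      rintro z (rfl | hz)
      · exact hxk
      · rw [Set.mem_singleton_iff] at hz
        subst hz
        refine (Ideal.span_le.mpr ?_ : Ideal.span {x, f} ≤ _) hy
        rintro z (rfl | hz)
        · exact hxk
        · rw [Set.mem_singleton_iff] at hz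
          subst hz
          exact hfk
    refine (Module.length_le_of_surjective (Submodule.liftQ _ _ hle) ?_).trans
      (length_quot_le x y hm r)
    intro z
    obtain ⟨w, rfl⟩ := Submodule.mkQ_surjective _ z
    obtain ⟨v, rfl⟩ := Submodule.mkQ_surjective _ w
    exact ⟨Submodule.Quotient.mk v, rfl⟩
  obtain ⟨s, hs⟩ := exists_span_of_length r (hker.trans_le hcok)
  choose t ht using fun i => Submodule.mkQ_surjective I ((s i : LinearMap.ker φ) : A ⧸ I)
  have htI : ∀ i, x * t i ∈ I := by
    intro i
    have h := (s i).2
    rw [LinearMap.mem_ker, ← ht i] at h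
    change x • (Submodule.Quotient.mk (t i) : A ⧸ I) = 0 at h
    rw [← Submodule.Quotient.mk_smul, Submodule.Quotient.mk_eq_zero] at h
    exact h
  let g : Fin (r + 1) → A := Fin.cons f fun i => x * t i
  have hg : Ideal.span (Set.range g) = I := by
    apply le_antisymm
    · rw [Ideal.span_le]
      rintro _ ⟨i, rfl⟩
      refine Fin.cases ?_ (fun i => ?_) i
      · exact hfI
      · exact htI i
    · refine Submodule.le_of_le_smul_of_le_jacobson_bot (I := maximalIdeal A)
        (IsNoetherian.noetherian I) (maximalIdeal_le_jacobson _) ?_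
      intro z hz
      obtain ⟨b, c, hbc⟩ := Ideal.mem_span_pair.mp (hIxf hz)
      have hxb : x * b ∈ I := by
        have : x * b = z - c * f := by rw [← hbc]; ring
        rw [this]
        exact I.sub_mem hz (I.mul_mem_left _ hfI)
      have hbk : (Submodule.Quotient.mk b : A ⧸ I) ∈ LinearMap.ker φ := by
        rw [LinearMap.mem_ker]
        change x • (Submodule.Quotient.mk b : A ⧸ I) = 0
        rw [← Submodule.Quotient.mk_smul, Submodule.Quotient.mk_eq_zero]
        exact hxb
      have hb : (⟨_, hbk⟩ : LinearMap.ker φ) ∈ Submodule.span A (Set.range s) := by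
        rw [hs]; trivial
      obtain ⟨d, hd⟩ := (Submodule.mem_span_range_iff_exists_fun A).mp hb
      have hd' := congrArg Subtype.val hd
      have hd2 : Submodule.mkQ I (∑ i, d i * t i) = Submodule.mkQ I b := by
        rw [map_sum]
        simp only [Submodule.coe_sum, Submodule.coe_smul] at hd'
        rw [Submodule.mkQ_apply I b, ← hd']
        refine Finset.sum_congr rfl fun i _ => ?_
        rw [← ht i, ← map_smul, smul_eq_mul]
      have hw : b - ∑ i, d i * t i ∈ I := (Submodule.Quotient.eq I).mp hd2.symm
      have hz' : z = (c * f + ∑ i, d i * (x * t i)) + x * (b - ∑ i, d i * t i) := by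
        rw [← hbc, mul_sub, Finset.mul_sum]
        have : ∑ i, d i * (x * t i) = ∑ i, x * (d i * t i) :=
          Finset.sum_congr rfl fun i _ => by ring
        rw [this]; ring
      rw [hz']
      refine Submodule.add_mem_sup (Ideal.add_mem _ ?_ (Ideal.sum_mem _ fun i _ => ?_))
        (Submodule.smul_mem_smul hxm hw)
      · exact Ideal.mul_mem_left _ _ (Ideal.subset_span ⟨0, rfl⟩)
      · exact Ideal.mul_mem_left _ _ (Ideal.subset_span ⟨i.succ, rfl⟩)
  simpa using mu_le I g hg

/-- `μ(m^n) ≥ n + 1`. -/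
lemma lt_mu_pow [IsNoetherianRing A] [IsLocalRing A] [Infinite (ResidueField A)]
    (hdim : ringKrullDim A = 2)
    (hreg : ∃ x y : A, maximalIdeal A = Ideal.span {x, y}) (n : ℕ) :
    n < mu (maximalIdeal A ^ n) := by
  classical
  by_contra! hle
  obtain ⟨x₀, y, hm₀⟩ := hreg
  obtain ⟨s, hcard, hspan⟩ := mu_spec (maximalIdeal A ^ n)
  have hx : x₀ ∈ maximalIdeal A := hm₀ ▸ Ideal.subset_span (by simp)
  have hy : y ∈ maximalIdeal A := hm₀ ▸ Ideal.subset_span (by simp)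
  have hmem : ∀ i : Fin (n + 1), ∃ c : s → A, ∑ j, c j * (j : A) =
      x₀ ^ (i : ℕ) * y ^ (n - (i : ℕ)) := by
    intro i
    have : n = (i : ℕ) + (n - (i : ℕ)) := by omega
    have hmem := Ideal.mul_mem_mul (Ideal.pow_mem_pow hx (i : ℕ))
      (Ideal.pow_mem_pow hy (n - (i : ℕ)))
    rw [← pow_add, ← this, ← hspan] at hmem
    apply Ideal.mem_span_range_iff_exists_fun.mp
    simpa using hmem
  choose c hc using hmem
  let v : Fin (n + 1) → (s → ResidueField A) := fun i j => residue A (c i j)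
  have hdep : ¬ LinearIndependent (ResidueField A) v := by
    intro h
    have := h.fintype_card_le_finrank
    simp at this
    omega
  obtain ⟨b, hb, i₀, hi₀⟩ := Fintype.not_linearIndependent_iff.mp hdep
  choose a ha using fun i => residue_surjective (R := A) (b i)
  have h₀ : a i₀ ∉ maximalIdeal A := by
    intro h
    exact hi₀ (by rw [← ha, (residue_eq_zero_iff _).mpr h])
  obtain ⟨x, hm, hyn⟩ := key x₀ y n hm₀ a i₀ h₀
  have hxm : x ∈ maximalIdeal A := hm ▸ Ideal.subset_span (by simp)
  have hf : ∑ i, a i * (x₀ ^ (i : ℕ) * y ^ (n - (i : ℕ))) ∈ maximalIdeal A ^ (n + 1) := by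
    have : ∑ i, a i * (x₀ ^ (i : ℕ) * y ^ (n - (i : ℕ)))
        = ∑ j : s, (∑ i, a i * c i j) * (j : A) := by
      simp_rw [← hc, Finset.mul_sum, Finset.sum_mul]
      rw [Finset.sum_comm]
      simp_rw [mul_assoc]
    rw [this, pow_succ']
    refine Ideal.sum_mem _ fun j _ => Ideal.mul_mem_mul ?_ ?_
    · rw [← residue_eq_zero_iff, map_sum]
      have := congrFun hb j
      simpa [v, ← ha] using this
    · rw [← hspan]; exact Ideal.subset_span j.2
  have hynx : y ^ n ∈ Ideal.span {x} := by
    obtain ⟨p, q, hpq⟩ := Ideal.mem_span_pair.mp hyn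
    rw [hm] at hf
    obtain ⟨p', q', hpq'⟩ := Ideal.mem_span_pair.mp (pow_pair_le' x y (n + 1) hf)
    have hu : IsUnit (1 - q * q' * y) := by
      by_contra hnu
      have h1 : 1 - q * q' * y ∈ maximalIdeal A := hnu
      have h2 : (1 : A) ∈ maximalIdeal A := by
        have := Ideal.add_mem _ h1 (Ideal.mul_mem_left _ (q * q') hy)
        simpa using this
      exact (maximalIdeal.isMaximal A).ne_top ((Ideal.eq_top_iff_one _).mpr h2)
    obtain ⟨w, hw⟩ := hu.exists_left_inv
    refine Ideal.mem_span_singleton'.mpr ⟨w * (p + q * p'), ?_⟩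
    linear_combination w * hpq + w * q * hpq' + y ^ n * hw
  have hmin : maximalIdeal A ∈ (Ideal.span {x}).minimalPrimes := by
    refine ⟨⟨inferInstance, (Ideal.span_singleton_le_iff_mem _).mpr hxm⟩, ?_⟩
    rintro q ⟨hq, hxq⟩ -
    rw [hm, Ideal.span_le]
    rintro z (rfl | hz)
    · exact hxq (Ideal.mem_span_singleton_self _)
    · rw [Set.mem_singleton_iff] at hz
      subst hz
      exact hq.mem_of_pow_mem _ (hxq hynx)
  have hht := Ideal.height_le_one_of_isPrincipal_of_mem_minimalPrimes _ _ hmin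
  have hdim' := maximalIdeal_height_eq_ringKrullDim (R := A)
  rw [hdim] at hdim'
  have h2 : (maximalIdeal A).height = 2 := WithBot.coe_injective hdim'
  rw [h2] at hht
  exact absurd hht (by decide)

/-- An ideal containing a power of `m` has a well-defined order. -/
lemma exists_ord [IsNoetherianRing A] [IsLocalRing A] [Infinite (ResidueField A)]
    (hdim : ringKrullDim A = 2)
    (hreg : ∃ x y : A, maximalIdeal A = Ideal.span {x, y})
    (I : Ideal A) (k : ℕ) (hk : maximalIdeal A ^ k ≤ I) :
    ∃ r, I ≤ maximalIdeal A ^ r ∧ ¬ I ≤ maximalIdeal A ^ (r + 1) := by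
  by_contra! h
  have hall : ∀ n, I ≤ maximalIdeal A ^ n := by
    intro n
    induction n with
    | zero => simp
    | succ n ih => exact h n ih
  have hbot : maximalIdeal A ^ k ≤ ⊥ := by
    refine Submodule.le_of_le_smul_of_le_jacobson_bot (I := maximalIdeal A)
        (IsNoetherian.noetherian _) (maximalIdeal_le_jacobson _) ?_
    rw [bot_sup_eq, smul_eq_mul, ← pow_succ']
    exact hk.trans (hall _)
  have := lt_mu_pow hdim hreg k
  rw [le_bot_iff.mp hbot] at this
  have h0 : mu (⊥ : Ideal A) ≤ 0 := Nat.sInf_le ⟨∅, rfl, by simp⟩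
  omega

end Helpers

/-- In a two-dimensional regular local ring (with infinite residue field), an
`m`-primary ideal has the strong Rees property iff it is a power of `m`. -/
theorem stmt5 {A : Type*} [CommRing A] [IsNoetherianRing A] [IsLocalRing A]
    [Infinite (ResidueField A)]
    (hdim : ringKrullDim A = 2)
    (hreg : ∃ x y : A, maximalIdeal A = Ideal.span {x, y})
    (I : Ideal A) (hIm : I ≤ maximalIdeal A)
    (hprimary : ∃ k : ℕ, maximalIdeal A ^ k ≤ I) :
    (∀ J : Ideal A, I < J → mu J < mu I) ↔ ∃ n : ℕ, 1 ≤ n ∧ I = maximalIdeal A ^ n := by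
  obtain ⟨k, hk⟩ := hprimary
  constructor
  · intro h
    obtain ⟨r, h1, h2⟩ := exists_ord hdim hreg I k hk
    refine ⟨r, ?_, ?_⟩
    · by_contra! h0
      have : r = 0 := by omega
      subst this
      exact h2 (by simpa using hIm)
    · by_contra hne
      have a1 := h _ (lt_of_le_of_ne h1 hne)
      have a2 := lt_mu_pow hdim hreg r
      have a3 := mu_le_ord hreg I k hk r h1 h2
      omega
  · rintro ⟨n, -, rfl⟩ J hJ
    obtain ⟨r, h1, h2⟩ := exists_ord hdim hreg J n hJ.le
    have a2 := lt_mu_pow hdim hreg n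
    have a3 := mu_le_ord hreg J n hJ.le r h1 h2
    have : r < n := by
      by_contra! hn
      exact absurd (h1.trans (Ideal.pow_le_pow_right hn)) hJ.not_ge
    omega
end

section
/- Let (A, m) be a two-dimensional regular local ring and I an m-primary ideal with ord(I) = n (i.e., I ⊆ m^n but I ⊄ m^{n+1}). Then μ(I) ≤ n + 1. -/
open IsLocalRing

/-- The filtration ideals: `m^(d+1)` plus the monomials of degree `d` with `x`-exponent `≥ i`. -/
def HH {A : Type*} [CommRing A] (x y : A) (d i : ℕ) : Ideal A :=
  Ideal.span {x, y} ^ (d + 1) ⊔ Ideal.span {z | ∃ c e, c + e = d ∧ i ≤ c ∧ z = x ^ c * y ^ e}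

/-- `(a, b)` is a leading exponent of `J`. -/
def SS {A : Type*} [CommRing A] (x y : A) (J : Ideal A) (a b : ℕ) : Prop :=
  ∃ g ∈ J, g - x ^ a * y ^ b ∈ HH x y (a + b) (a + 1)

lemma HH_mono_mem {A : Type*} [CommRing A] (x y : A) {d i c e : ℕ} (h : c + e = d) (hi : i ≤ c) :
    x ^ c * y ^ e ∈ HH x y d i :=
  Ideal.mem_sup_right (Ideal.subset_span ⟨c, e, h, hi, rfl⟩)

lemma mul_HH {A : Type*} [CommRing A] (x y w : A) (d i k : ℕ) (hw : w ∈ Ideal.span {x, y})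
    (h : ∀ c e, c + e = d → i ≤ c → w * (x ^ c * y ^ e) ∈ HH x y (d + 1) k)
    {g : A} (hg : g ∈ HH x y d i) : w * g ∈ HH x y (d + 1) k := by
  obtain ⟨r, hr, s, hs, rfl⟩ := Submodule.mem_sup.1 hg
  rw [mul_add]
  refine add_mem (Ideal.mem_sup_left ?_) ?_
  · rw [pow_succ']
    exact Ideal.mul_mem_mul hw hr
  · clear hg
    induction hs using Submodule.span_induction with
    | mem z hz =>
      obtain ⟨c, e, h1, h2, rfl⟩ := hz
      exact h c e h1 h2
    | zero => simp
    | add u v _ _ hu hv => rw [mul_add]; exact add_mem hu hv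
    | smul t u _ hu =>
      rw [smul_eq_mul, mul_left_comm]; exact Ideal.mul_mem_left _ _ hu

lemma x_HH {A : Type*} [CommRing A] (x y : A) (d i : ℕ)
    {g : A} (hg : g ∈ HH x y d i) : x * g ∈ HH x y (d + 1) (i + 1) := by
  refine mul_HH x y x d i (i + 1) (Ideal.subset_span (by simp)) ?_ hg
  intro c e h1 h2
  have : x * (x ^ c * y ^ e) = x ^ (c + 1) * y ^ e := by ring
  rw [this]
  exact HH_mono_mem x y (by omega) (by omega)

lemma y_HH {A : Type*} [CommRing A] (x y : A) (d i : ℕ)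
    {g : A} (hg : g ∈ HH x y d i) : y * g ∈ HH x y (d + 1) i := by
  refine mul_HH x y y d i i (Ideal.subset_span (by simp)) ?_ hg
  intro c e h1 h2
  have : y * (x ^ c * y ^ e) = x ^ c * y ^ (e + 1) := by ring
  rw [this]
  exact HH_mono_mem x y (by omega) (by omega)

lemma SS_x {A : Type*} [CommRing A] {x y : A} {J : Ideal A} {a b : ℕ} (h : SS x y J a b) :
    SS x y J (a + 1) b := by
  obtain ⟨g, hg, h⟩ := h
  refine ⟨x * g, J.mul_mem_left _ hg, ?_⟩
  have := x_HH x y _ _ h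
  rw [show a + 1 + b = a + b + 1 by ring]
  convert this using 1
  ring

lemma SS_y {A : Type*} [CommRing A] {x y : A} {J : Ideal A} {a b : ℕ} (h : SS x y J a b) :
    SS x y J a (b + 1) := by
  obtain ⟨g, hg, h⟩ := h
  refine ⟨y * g, J.mul_mem_left _ hg, ?_⟩
  have := y_HH x y _ _ h
  rw [show a + (b + 1) = a + b + 1 by ring]
  convert this using 1
  ring

lemma SS_le {A : Type*} [CommRing A] {x y : A} {J : Ideal A} {a b a' b' : ℕ}
    (ha : a ≤ a') (hb : b ≤ b') (h : SS x y J a b) : SS x y J a' b' := by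
  have h1 : SS x y J a' b := by
    induction ha with
    | refl => exact h
    | step _ ih => exact SS_x ih
  induction hb with
  | refl => exact h1
  | step _ ih => exact SS_y ih

lemma HH_zero {A : Type*} [CommRing A] (x y : A) (d : ℕ) :
    Ideal.span {x, y} ^ d ≤ HH x y d 0 := by
  induction d with
  | zero => 
    intro g _
    have := HH_mono_mem x y (d := 0) (i := 0) (c := 0) (e := 0) rfl le_rfl
    have h2 := Ideal.mul_mem_left _ g this
    simpa using h2
  | succ d ih =>
    rw [pow_succ']
    refine Ideal.mul_le.2 ?_
    intro r hr s hs
    obtain ⟨u, v, rfl⟩ := Ideal.mem_span_pair.1 hr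
    rw [add_mul, mul_assoc, mul_assoc]
    refine add_mem (Ideal.mul_mem_left _ _ ?_) (Ideal.mul_mem_left _ _ ?_)
    · have := x_HH x y _ _ (ih hs)
      refine Set.mem_of_subset_of_mem (SetLike.coe_subset_coe.2
        (sup_le_sup le_rfl (Ideal.span_mono ?_))) this
      rintro z ⟨c, e, h1, h2, h3⟩
      exact ⟨c, e, h1, by omega, h3⟩
    · exact y_HH x y _ _ (ih hs)

lemma HH_top {A : Type*} [CommRing A] (x y : A) (d : ℕ) :
    HH x y d (d + 1) ≤ Ideal.span {x, y} ^ (d + 1) := by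
  refine sup_le le_rfl (Ideal.span_le.2 ?_)
  rintro z ⟨c, e, h1, h2, h3⟩
  omega

lemma HH_step {A : Type*} [CommRing A] [IsLocalRing A] {x y : A}
    (hm : maximalIdeal A = Ideal.span {x, y}) (a b : ℕ) {g : A}
    (hg : g ∈ HH x y (a + b) a) (hg' : g ∉ HH x y (a + b) (a + 1)) :
    ∃ u : A, IsUnit u ∧ g - u * (x ^ a * y ^ b) ∈ HH x y (a + b) (a + 1) := by
  have hle : HH x y (a + b) a ≤ Ideal.span {x ^ a * y ^ b} ⊔ HH x y (a + b) (a + 1) := by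
    refine sup_le (le_trans le_sup_left le_sup_right) (Ideal.span_le.2 ?_)
    rintro z ⟨c, e, h1, h2, rfl⟩
    rcases h2.eq_or_lt with rfl | h2
    · obtain rfl : e = b := by omega
      exact Ideal.mem_sup_left (Ideal.subset_span rfl)
    · exact Ideal.mem_sup_right (HH_mono_mem x y h1 h2)
  obtain ⟨r, hr, s, hs, rfl⟩ := Submodule.mem_sup.1 (hle hg)
  obtain ⟨u, rfl⟩ := Ideal.mem_span_singleton'.1 hr
  refine ⟨u, ?_, by simpa using hs⟩
  by_contra hu
  apply hg'
  refine add_mem (Ideal.mem_sup_left ?_) hs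
  have hu' : u ∈ Ideal.span {x, y} := by
    rw [← hm]; exact (mem_maximalIdeal _).2 hu
  rw [pow_succ']
  refine Ideal.mul_mem_mul hu' ?_
  rw [pow_add]
  exact Ideal.mul_mem_mul (Ideal.pow_mem_pow (Ideal.subset_span (by simp)) _)
    (Ideal.pow_mem_pow (Ideal.subset_span (by simp)) _)

lemma SS_of_unit {A : Type*} [CommRing A] {x y : A} {I : Ideal A} {a b : ℕ} {g u : A}
    (hg : g ∈ I) (hu : IsUnit u)
    (h : g - u * (x ^ a * y ^ b) ∈ HH x y (a + b) (a + 1)) : SS x y I a b := by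
  obtain ⟨v, hv⟩ := hu.exists_left_inv
  refine ⟨v * g, I.mul_mem_left _ hg, ?_⟩
  have := Ideal.mul_mem_left _ v h
  rwa [mul_sub, ← mul_assoc, hv, one_mul] at this

lemma reduce {A : Type*} [CommRing A] [IsLocalRing A] {x y : A}
    (hm : maximalIdeal A = Ideal.span {x, y}) {I J : Ideal A} (hJI : J ≤ I)
    (hS : ∀ a b, SS x y I a b → SS x y J a b) (d i : ℕ) (hi : i ≤ d + 1) {g : A} (hg : g ∈ I)
    (hgd : g ∈ Ideal.span {x, y} ^ d) : ∃ j ∈ J, g - j ∈ HH x y d i := by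
  induction i with
  | zero => exact ⟨0, J.zero_mem, by simpa using HH_zero x y d hgd⟩
  | succ i ih =>
    obtain ⟨j, hj, h⟩ := ih (by omega)
    obtain ⟨b, rfl⟩ := Nat.exists_eq_add_of_le (show i ≤ d by omega)
    by_cases h' : g - j ∈ HH x y (i + b) (i + 1)
    · exact ⟨j, hj, h'⟩
    · obtain ⟨u, hu, h2⟩ := HH_step hm i b h h'
      obtain ⟨f, hf, h3⟩ := hS i b (SS_of_unit (I.sub_mem hg (hJI hj)) hu h2)
      refine ⟨j + u * f, J.add_mem hj (J.mul_mem_left _ hf), ?_⟩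
      have := sub_mem h2 (Ideal.mul_mem_left _ u h3)
      convert this using 1
      ring

lemma reduce_all {A : Type*} [CommRing A] [IsLocalRing A] {x y : A}
    (hm : maximalIdeal A = Ideal.span {x, y}) {I J : Ideal A} (hJI : J ≤ I)
    (hS : ∀ a b, SS x y I a b → SS x y J a b) (d : ℕ) {g : A} (hg : g ∈ I) :
    ∃ j ∈ J, g - j ∈ Ideal.span {x, y} ^ d := by
  induction d with
  | zero => exact ⟨0, J.zero_mem, by simp⟩
  | succ d ih =>
    obtain ⟨j, hj, h⟩ := ih
    obtain ⟨j', hj', h'⟩ := reduce hm hJI hS d (d + 1) le_rfl (I.sub_mem hg (hJI hj)) h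
    exact ⟨j + j', J.add_mem hj hj', by rw [← sub_sub]; exact HH_top x y d h'⟩

lemma exists_lead {A : Type*} [CommRing A] [IsLocalRing A] {x y : A}
    (hm : maximalIdeal A = Ideal.span {x, y}) {I : Ideal A} {n : ℕ} {g : A} (hg : g ∈ I)
    (h1 : g ∈ Ideal.span {x, y} ^ n) (h2 : g ∉ Ideal.span {x, y} ^ (n + 1)) :
    ∃ p q, p + q = n ∧ SS x y I p q := by
  by_contra! hcon
  have key : ∀ i, i ≤ n + 1 → g ∈ HH x y n i := by
    intro i
    induction i with
    | zero => intro _; exact HH_zero x y n h1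
    | succ i ih =>
      intro hi
      by_contra h'
      obtain ⟨b, rfl⟩ := Nat.exists_eq_add_of_le (show i ≤ n by omega)
      obtain ⟨u, hu, h3⟩ := HH_step hm i b (ih (by omega)) h'
      exact hcon i b rfl (SS_of_unit hg hu h3)
  exact h2 (HH_top x y n (key _ le_rfl))

/-- In a two-dimensional regular local ring, an `m`-primary ideal of order `n`
has at most `n + 1` generators. -/
theorem stmt6 {A : Type*} [CommRing A] [IsNoetherianRing A] [IsLocalRing A]
    (hdim : ringKrullDim A = 2)
    (hreg : ∃ x y : A, maximalIdeal A = Ideal.span {x, y})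
    (I : Ideal A) (hIm : I ≤ maximalIdeal A)
    (hprimary : ∃ k : ℕ, maximalIdeal A ^ k ≤ I)
    (n : ℕ) (hord1 : I ≤ maximalIdeal A ^ n) (hord2 : ¬ I ≤ maximalIdeal A ^ (n + 1)) :
    mu I ≤ n + 1 := by
  classical
  obtain ⟨x, y, hm⟩ := hreg
  obtain ⟨k, hk⟩ := hprimary
  obtain ⟨g, hg, hgn⟩ := SetLike.not_le_iff_exists.1 hord2
  obtain ⟨p, q, hpq, hSpq⟩ := exists_lead hm hg (hm ▸ hord1 hg) (hm ▸ hgn)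
  have hex : ∀ a b, ∃ h ∈ I, SS x y I a b → h - x ^ a * y ^ b ∈ HH x y (a + b) (a + 1) := by
    intro a b
    by_cases h : SS x y I a b
    · obtain ⟨g, hg, h⟩ := h
      exact ⟨g, hg, fun _ => h⟩
    · exact ⟨0, I.zero_mem, fun h' => absurd h' h⟩
  choose h hhI hh using hex
  let T : Finset A := insert (h p q)
    ((Finset.range p).image (fun a => h a (sInf {b | SS x y I a b})) ∪
     (Finset.range q).image (fun b => h (sInf {a | SS x y I a b}) b))
  have hTcard : T.card ≤ n + 1 := by
    refine (Finset.card_insert_le _ _).trans ?_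
    have h1 := Finset.card_union_le
      ((Finset.range p).image (fun a => h a (sInf {b | SS x y I a b})))
      ((Finset.range q).image (fun b => h (sInf {a | SS x y I a b}) b))
    have h2 := Finset.card_image_le (s := Finset.range p)
      (f := fun a => h a (sInf {b | SS x y I a b}))
    have h3 := Finset.card_image_le (s := Finset.range q)
      (f := fun b => h (sInf {a | SS x y I a b}) b)
    rw [Finset.card_range] at h2 h3
    omega
  have hJI : Ideal.span (T : Set A) ≤ I := by
    refine Ideal.span_le.2 ?_
    intro z hz
    simp only [T, Finset.coe_insert, Finset.coe_union, Finset.coe_image, Set.mem_insert_iff,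
      Set.mem_union, Set.mem_image] at hz
    rcases hz with rfl | ⟨a, _, rfl⟩ | ⟨b, _, rfl⟩ <;> exact hhI _ _
  have hS : ∀ a b, SS x y I a b → SS x y (Ideal.span (T : Set A)) a b := by
    intro a b hab
    by_cases ha : a < p
    · have hmem : SS x y I a (sInf {b | SS x y I a b}) :=
        Nat.sInf_mem (s := {b | SS x y I a b}) ⟨b, hab⟩
      refine SS_le le_rfl (Nat.sInf_le (s := {b | SS x y I a b}) hab)
        ⟨_, Ideal.subset_span ?_, hh _ _ hmem⟩
      exact Finset.mem_coe.2 (Finset.mem_insert_of_mem (Finset.mem_union_left _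
        (Finset.mem_image.2 ⟨a, Finset.mem_range.2 ha, rfl⟩)))
    by_cases hb : b < q
    · have hmem : SS x y I (sInf {a | SS x y I a b}) b :=
        Nat.sInf_mem (s := {a | SS x y I a b}) ⟨a, hab⟩
      refine SS_le (Nat.sInf_le (s := {a | SS x y I a b}) hab) le_rfl
        ⟨_, Ideal.subset_span ?_, hh _ _ hmem⟩
      exact Finset.mem_coe.2 (Finset.mem_insert_of_mem (Finset.mem_union_right _
        (Finset.mem_image.2 ⟨b, Finset.mem_range.2 hb, rfl⟩)))
    · exact SS_le (not_lt.1 ha) (not_lt.1 hb)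
        ⟨_, Ideal.subset_span (Finset.mem_coe.2 (Finset.mem_insert_self _ _)), hh _ _ hSpq⟩
  have hle : I ≤ Ideal.span (T : Set A) ⊔ maximalIdeal A • I := by
    intro f hf
    obtain ⟨j, hj, hd⟩ := reduce_all hm hJI hS (k + 1) hf
    rw [← hm, pow_succ'] at hd
    have : f = j + (f - j) := by ring
    rw [this]
    exact add_mem (Ideal.mem_sup_left hj) (Ideal.mem_sup_right (Ideal.mul_mono_right hk hd))
  have hIJ : I ≤ Ideal.span (T : Set A) :=
    Submodule.le_of_le_smul_of_le_jacobson_bot (IsNoetherian.noetherian I)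
      (IsLocalRing.maximalIdeal_le_jacobson ⊥) hle
  have hmu : mu I ≤ T.card := Nat.sInf_le ⟨T, rfl, le_antisymm hJI hIJ⟩
  exact hmu.trans hTcard
end

section
/- Let (A, m) be a Noetherian local ring, ℓ ≥ 1, J ⊇ m^ℓ an ideal, and x ∈ m with (m^{ℓ+1} : x) = m^ℓ. Then length_A(mJ/m^{ℓ+1}) = length_A(J/m^ℓ) + (μ(m^ℓ) − μ(J)). -/
open IsLocalRing

/-- The length of an `A`-module: the Krull dimension of its lattice of submodules. -/
noncomputable def moduleLength (A M : Type*) [CommRing A] [AddCommGroup M] [Module A M] :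
    WithBot ℕ∞ :=
  Order.krullDim (Submodule A M)

/-- For an ideal `I'` contained in an ideal `J'`, the quotient module `J'/I'`. -/
abbrev idealQuot {A : Type*} [CommRing A] (J' I' : Ideal A) :=
  J' ⧸ (Submodule.comap J'.subtype I')

theorem mu_eq_spanFinrank {A : Type*} [CommRing A] [IsNoetherianRing A] (I : Ideal A) :
    mu I = Submodule.spanFinrank I := by
  have fg : Submodule.FG I := IsNoetherian.noetherian I
  apply le_antisymm
  · exact Nat.sInf_le fg.exists_span_finset_card_eq_spanFinrank
  · have hne : {n | ∃ s : Finset A, s.card = n ∧ Ideal.span (s : Set A) = I}.Nonempty :=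
      ⟨_, fg.exists_span_finset_card_eq_spanFinrank⟩
    obtain ⟨s, hs, hI⟩ := Nat.sInf_mem hne
    have h := Submodule.spanFinrank_span_le_ncard_of_finite (R := A) s.finite_toSet
    rw [Set.ncard_coe_finset, hs] at h
    change (Ideal.span (s : Set A)).spanFinrank ≤ _ at h
    rw [hI] at h
    exact h

theorem length_quot_mu {A : Type*} [CommRing A] [IsNoetherianRing A] [IsLocalRing A]
    (I : Ideal A) : Module.length A (idealQuot I (maximalIdeal A * I)) = (mu I : ℕ∞) := by
  have e : Submodule.comap I.subtype (maximalIdeal A * I)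
      = maximalIdeal A • (⊤ : Submodule A I) := by
    apply Submodule.map_injective_of_injective (Submodule.subtype_injective I)
    rw [Submodule.map_smul'', Submodule.map_top, Submodule.range_subtype,
      Submodule.map_comap_subtype]
    exact inf_eq_right.mpr Ideal.mul_le_right
  rw [(Submodule.quotEquivOfEq _ _ e).length_eq, mu_eq_spanFinrank,
    IsLocalRing.spanFinrank_eq_finrank_quotient I (IsNoetherian.noetherian I)]
  rw [Module.length_eq_of_surjective (R := A ⧸ maximalIdeal A) Ideal.Quotient.mk_surjective]
  let : Field (A ⧸ maximalIdeal A) := Ideal.Quotient.field _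
  have : Module.Finite (A ⧸ maximalIdeal A) (I ⧸ maximalIdeal A • (⊤ : Submodule A I)) :=
    Module.Finite.of_restrictScalars_finite A _ _
  exact Module.length_eq_finrank _ _

theorem length_tower {A : Type*} [CommRing A] (P Q R : Ideal A) (hPQ : P ≤ Q) (hQR : Q ≤ R) :
    Module.length A (idealQuot R P)
      = Module.length A (idealQuot Q P) + Module.length A (idealQuot R Q) := by
  let f : idealQuot Q P →ₗ[A] idealQuot R P :=
    Submodule.mapQ _ _ (Submodule.inclusion hQR) (fun _ h => h)
  let g : idealQuot R P →ₗ[A] idealQuot R Q :=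
    Submodule.mapQ _ _ LinearMap.id (fun _ h => hPQ h)
  refine Module.length_eq_add_of_exact f g ?_ ?_ ?_
  · rw [injective_iff_map_eq_zero]
    intro a
    obtain ⟨a, rfl⟩ := Submodule.Quotient.mk_surjective _ a
    intro h
    have h' := (Submodule.Quotient.mk_eq_zero _).mp h
    exact (Submodule.Quotient.mk_eq_zero _).mpr h'
  · intro b
    obtain ⟨b, rfl⟩ := Submodule.Quotient.mk_surjective _ b
    exact ⟨Submodule.Quotient.mk b, rfl⟩
  · intro b
    constructor
    · obtain ⟨b, rfl⟩ := Submodule.Quotient.mk_surjective _ b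
      intro h
      have h0 := (Submodule.Quotient.mk_eq_zero _).mp h
      have h' : (b : A) ∈ Q := h0
      exact ⟨Submodule.Quotient.mk ⟨b, h'⟩, rfl⟩
    · rintro ⟨a, rfl⟩
      obtain ⟨a, rfl⟩ := Submodule.Quotient.mk_surjective _ a
      exact (Submodule.Quotient.mk_eq_zero _).mpr a.2

theorem length_top_pow_ne_top {A : Type*} [CommRing A] [IsNoetherianRing A] [IsLocalRing A]
    (k : ℕ) : Module.length A (idealQuot (⊤ : Ideal A) (maximalIdeal A ^ k)) ≠ ⊤ := by
  induction k with
  | zero =>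
    have : Subsingleton (idealQuot (⊤ : Ideal A) (maximalIdeal A ^ 0)) := by
      rw [Submodule.Quotient.subsingleton_iff]
      simp
    simp [Module.length_eq_zero]
  | succ k ih =>
    rw [length_tower _ (maximalIdeal A ^ k) _ (Ideal.pow_le_pow_right (Nat.le_succ k)) le_top,
      pow_succ', length_quot_mu]
    exact WithTop.add_ne_top.mpr ⟨ENat.natCast_ne_top _, ih⟩

/-- `length(mJ/m^{ℓ+1}) = length(J/m^ℓ) + (μ(m^ℓ) − μ(J))`. -/
theorem stmt8 {A : Type*} [CommRing A] [IsNoetherianRing A] [IsLocalRing A]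
    (ℓ : ℕ) (hℓ : 1 ≤ ℓ) (J : Ideal A) (hJ : maximalIdeal A ^ ℓ ≤ J)
    (x : A) (hx : x ∈ maximalIdeal A)
    (hcolon : (maximalIdeal A ^ (ℓ + 1)).colon (Ideal.span {x}) = maximalIdeal A ^ ℓ) :
    moduleLength A (idealQuot (maximalIdeal A * J) (maximalIdeal A ^ (ℓ + 1)))
      = moduleLength A (idealQuot J (maximalIdeal A ^ ℓ))
        + ((mu (maximalIdeal A ^ ℓ) - mu J : ℕ) : WithBot ℕ∞) := by
  have hle : maximalIdeal A ^ (ℓ + 1) ≤ maximalIdeal A * J := by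
    rw [pow_succ']
    exact Ideal.mul_mono_right hJ
  have h1 := length_tower _ _ _ hle (Ideal.mul_le_right : maximalIdeal A * J ≤ J)
  have h2 := length_tower _ _ _ (Ideal.pow_le_pow_right (Nat.le_succ ℓ)) hJ
  have h3 := length_quot_mu (maximalIdeal A ^ ℓ)
  rw [← pow_succ'] at h3
  rw [length_quot_mu, h2, h3] at h1
  have hfin : Module.length A (idealQuot J (maximalIdeal A ^ ℓ)) ≠ ⊤ := by
    have h := length_top_pow_ne_top (A := A) ℓ
    rw [length_tower _ _ _ hJ le_top] at h
    exact (WithTop.add_ne_top.mp h).1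
  have hinj : Module.length A (idealQuot J (maximalIdeal A ^ ℓ)) ≤
      Module.length A (idealQuot (maximalIdeal A * J) (maximalIdeal A ^ (ℓ + 1))) := by
    let f0 : J →ₗ[A] (maximalIdeal A * J : Ideal A) :=
      LinearMap.codRestrict _ ((LinearMap.mulLeft A x).comp J.subtype)
        (fun a => Ideal.mul_mem_mul hx a.2)
    let f : idealQuot J (maximalIdeal A ^ ℓ) →ₗ[A]
        idealQuot (maximalIdeal A * J) (maximalIdeal A ^ (ℓ + 1)) :=
      Submodule.mapQ _ _ f0 (fun a (h : (a : A) ∈ maximalIdeal A ^ ℓ) => by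
        change x * (a : A) ∈ maximalIdeal A ^ (ℓ + 1)
        rw [pow_succ']
        exact Ideal.mul_mem_mul hx h)
    refine Module.length_le_of_injective f ?_
    rw [injective_iff_map_eq_zero]
    intro a
    obtain ⟨a, rfl⟩ := Submodule.Quotient.mk_surjective _ a
    intro h
    have h0 := (Submodule.Quotient.mk_eq_zero _).mp h
    have h' : x * (a : A) ∈ maximalIdeal A ^ (ℓ + 1) := h0
    refine (Submodule.Quotient.mk_eq_zero _).mpr ?_
    change (a : A) ∈ maximalIdeal A ^ ℓ
    rw [← hcolon, Ideal.mem_colon_span_singleton, mul_comm]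
    exact h'
  simp only [moduleLength, ← Module.coe_length]
  generalize Module.length A (idealQuot J (maximalIdeal A ^ ℓ)) = a at *
  generalize Module.length A (idealQuot (maximalIdeal A * J) (maximalIdeal A ^ (ℓ + 1))) = b at *
  generalize mu (maximalIdeal A ^ ℓ) = p at *
  generalize mu J = q at *
  lift a to ℕ using hfin
  have hb : b ≠ ⊤ := by
    rintro rfl
    rw [top_add] at h1
    exact absurd h1 (by exact_mod_cast ENat.natCast_ne_top (p + a))
  lift b to ℕ using hb
  norm_cast at h1 hinj
  have hb : b = a + (p - q) := by omega
  rw [hb, Nat.cast_add]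
  rfl
end

section
/- Let (A, m) be a Noetherian local ring with dim A ≥ 1 such that the associated graded ring G = ⊕_{n≥0} m^n/m^{n+1} has positive depth. Then m^ℓ has the Rees property for every ℓ ≥ 1: for every ideal J ⊇ m^ℓ, μ(J) ≤ μ(m^ℓ). -/
open IsLocalRing

theorem length_quot_eq_mu {A : Type*} [CommRing A] [IsNoetherianRing A] [IsLocalRing A]
    (I : Ideal A) :
    Module.length A (I ⧸ (maximalIdeal A) • (⊤ : Submodule A I)) = mu I := by
  rw [mu_eq_spanFinrank,
    IsLocalRing.spanFinrank_eq_finrank_quotient (N := I) I.fg_of_isNoetherianRing]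
  letI : Field (A ⧸ maximalIdeal A) := Ideal.Quotient.field _
  have : Module.Finite (A ⧸ maximalIdeal A) (I ⧸ (maximalIdeal A) • (⊤ : Submodule A I)) :=
    Module.Finite.of_restrictScalars_finite A _ _
  rw [Module.length_eq_of_surjective (S := A) (R := A ⧸ maximalIdeal A)
    (Ideal.Quotient.mk_surjective)]
  exact Module.length_eq_finrank _ _

theorem length_mul {A : Type*} [CommRing A] [IsNoetherianRing A] [IsLocalRing A]
    (I : Ideal A) :
    Module.length A (A ⧸ maximalIdeal A * I) = mu I + Module.length A (A ⧸ I) := by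
  rw [← length_quot_eq_mu]
  have key : (maximalIdeal A) • (⊤ : Submodule A I) =
      Submodule.comap I.subtype (maximalIdeal A * I) := by
    apply Submodule.map_injective_of_injective I.injective_subtype
    rw [Submodule.map_smul'', Submodule.map_top, Submodule.range_subtype,
      Submodule.map_comap_subtype, inf_eq_right.mpr Ideal.mul_le_right]
    rfl
  refine Module.length_eq_add_of_exact
    (Submodule.mapQ _ (maximalIdeal A * I) I.subtype key.le)
    (Submodule.factor (Ideal.mul_le_right : maximalIdeal A * I ≤ I)) ?_ ?_ ?_
  · rw [← LinearMap.ker_eq_bot, Submodule.ker_mapQ, key, ← key, Submodule.mkQ_map_self]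
  · exact Submodule.factor_surjective _
  · intro y
    obtain ⟨y, rfl⟩ := Submodule.mkQ_surjective _ y
    constructor
    · intro h
      have hy : y ∈ I := (Submodule.Quotient.mk_eq_zero _).mp h
      exact ⟨Submodule.Quotient.mk ⟨y, hy⟩, by simp⟩
    · rintro ⟨z, hz⟩
      obtain ⟨z, rfl⟩ := Submodule.mkQ_surjective _ z
      rw [← hz]
      exact (Submodule.Quotient.mk_eq_zero I).mpr z.2

theorem length_pow_ne_top {A : Type*} [CommRing A] [IsNoetherianRing A] [IsLocalRing A] (n : ℕ) :
    Module.length A (A ⧸ maximalIdeal A ^ n) ≠ ⊤ := by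
  induction n with
  | zero =>
    have : Subsingleton (A ⧸ maximalIdeal A ^ 0) := by
      rw [pow_zero, Ideal.one_eq_top]
      exact Ideal.Quotient.subsingleton_iff.mpr rfl
    simp [Module.length_eq_zero]
  | succ n ih =>
    rw [pow_succ', length_mul]
    exact WithTop.add_ne_top.mpr ⟨ENat.natCast_ne_top _, ih⟩

theorem length_le_x {A : Type*} [CommRing A] (K J : Ideal A) (x : A)
    (h : ∀ w ∈ J, x * w ∈ K) :
    Module.length A (A ⧸ K) ≤ Module.length A (A ⧸ J) +
        Module.length A (A ⧸ (K ⊔ Ideal.span {x})) ∧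
    ((∀ w, x * w ∈ K → w ∈ J) → Module.length A (A ⧸ K) = Module.length A (A ⧸ J) +
        Module.length A (A ⧸ (K ⊔ Ideal.span {x}))) := by
  let f : (A ⧸ J) →ₗ[A] (A ⧸ K) := Submodule.mapQ J K (LinearMap.mulLeft A x) h
  let g : (A ⧸ K) →ₗ[A] (A ⧸ (K ⊔ Ideal.span {x})) := Submodule.factor le_sup_left
  have hg : Function.Surjective g := Submodule.factor_surjective _
  have hex : Function.Exact f g := by
    intro y
    obtain ⟨y, rfl⟩ := Submodule.mkQ_surjective _ y
    constructor
    · intro h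
      have hy : y ∈ K ⊔ Ideal.span {x} := (Submodule.Quotient.mk_eq_zero _).mp h
      obtain ⟨k, hk, t, ht, rfl⟩ := Submodule.mem_sup.mp hy
      obtain ⟨a, rfl⟩ := Ideal.mem_span_singleton'.mp ht
      refine ⟨Submodule.mkQ _ a, ?_⟩
      have : f (Submodule.mkQ _ a) = Submodule.mkQ K (x * a) := rfl
      rw [this, Submodule.mkQ_apply, Submodule.mkQ_apply, Submodule.Quotient.eq]
      have e : x * a - (k + a * x) = -k := by ring
      rw [e]
      exact K.neg_mem hk
    · rintro ⟨z, hz⟩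
      obtain ⟨z, rfl⟩ := Submodule.mkQ_surjective _ z
      rw [← hz]
      change Submodule.mkQ (K ⊔ Ideal.span {x}) (x * z) = 0
      rw [Submodule.mkQ_apply, Submodule.Quotient.mk_eq_zero]
      exact Ideal.mem_sup_right (Ideal.mul_mem_right _ _ (Ideal.mem_span_singleton_self x))
  constructor
  · have hex' : Function.Exact (LinearMap.range f).subtype g := by
      intro y
      rw [hex y]
      simp
    rw [Module.length_eq_add_of_exact (LinearMap.range f).subtype g
      (Submodule.injective_subtype _) hg hex']
    gcongr
    exact Module.length_le_of_surjective f.rangeRestrict f.surjective_rangeRestrict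
  · intro hinj
    refine Module.length_eq_add_of_exact f g ?_ hg hex
    rw [← LinearMap.ker_eq_bot, LinearMap.ker_eq_bot']
    intro z hz
    obtain ⟨z, rfl⟩ := Submodule.mkQ_surjective _ z
    change Submodule.mkQ K (x * z) = 0 at hz
    rw [Submodule.mkQ_apply, Submodule.Quotient.mk_eq_zero] at hz ⊢
    exact hinj z hz

/-- `m`-full ideals of finite colength have the Rees property. -/
theorem rees_of_full {A : Type*} [CommRing A] [IsNoetherianRing A] [IsLocalRing A]
    (I J : Ideal A) (hIJ : I ≤ J) (x : A) (hx : x ∈ maximalIdeal A)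
    (hfin : Module.length A (A ⧸ I) ≠ ⊤)
    (hfull : ∀ w, x * w ∈ maximalIdeal A * I → w ∈ I) : mu J ≤ mu I := by
  have hJfin : Module.length A (A ⧸ J) ≠ ⊤ :=
    ne_top_of_le_ne_top hfin
      (Module.length_le_of_surjective (Submodule.factor hIJ) (Submodule.factor_surjective _))
  have h1 := (length_le_x (maximalIdeal A * I) I x (fun w hw => Ideal.mul_mem_mul hx hw)).2 hfull
  have h2 := (length_le_x (maximalIdeal A * J) J x (fun w hw => Ideal.mul_mem_mul hx hw)).1
  rw [length_mul, add_comm] at h1 h2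
  have h1' := (ENat.add_le_add_iff_left hfin).mp h1.ge
  have h2' := (ENat.add_le_add_iff_left hJfin).mp h2
  have hle : maximalIdeal A * I ⊔ Ideal.span {x} ≤ maximalIdeal A * J ⊔ Ideal.span {x} :=
    sup_le_sup_right (Ideal.mul_mono_right hIJ) _
  have h3 := Module.length_le_of_surjective (Submodule.factor hle) (Submodule.factor_surjective _)
  have : (mu J : ℕ∞) ≤ mu I := h2'.trans (h3.trans h1')
  exact_mod_cast this

/-- A finite family of proper submodules of `m` containing `m²` does not cover `m`. -/
theorem avoid {A : Type*} [CommRing A] [IsLocalRing A]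
    [Infinite (ResidueField A)] {ι : Type*} (s : Finset ι)
    (V : ι → Submodule A (maximalIdeal A))
    (hV : ∀ i ∈ s, ∀ a ∈ maximalIdeal A, ∀ y, a • y ∈ V i) (hne : ∀ i ∈ s, V i ≠ ⊤) :
    ∃ y, ∀ i ∈ s, y ∉ V i := by
  by_contra! hcon
  have hcov : ⋃ i ∈ s, (V i : Set (maximalIdeal A)) = Set.univ := by
    ext y
    simpa using hcon y
  obtain ⟨k, hk, hfi⟩ := Submodule.exists_finiteIndex_of_cover hcov
  have hfinq : Finite (maximalIdeal A ⧸ V k) := AddSubgroup.finite_quotient_of_finiteIndex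
  obtain ⟨y, hy⟩ : ∃ y, y ∉ V k := by
    by_contra! h
    exact hne k hk (eq_top_iff.mpr fun y _ => h y)
  let f : A →ₗ[A] (maximalIdeal A ⧸ V k) := LinearMap.toSpanSingleton A _ (Submodule.mkQ _ y)
  have hker : LinearMap.ker f = maximalIdeal A := by
    symm
    apply (maximalIdeal.isMaximal A).eq_of_le
    · intro h
      have h1 : (1 : A) ∈ LinearMap.ker f := h ▸ Submodule.mem_top
      apply hy
      simpa [f] using h1
    · intro a ha
      rw [LinearMap.mem_ker]
      change a • Submodule.mkQ (V k) y = 0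
      rw [← map_smul, Submodule.mkQ_apply, Submodule.Quotient.mk_eq_zero]
      exact hV k hk a ha y
  have hfq : Finite (A ⧸ LinearMap.ker f) :=
    Finite.of_injective _ f.quotKerEquivRange.injective
  rw [hker] at hfq
  have : Finite (ResidueField A) := hfq
  exact not_finite (ResidueField A)

open Polynomial in
/-- The kernel of the map from the Rees algebra to the associated graded ring. -/
def grKer {A : Type*} [CommRing A] (m : Ideal A) : Ideal (reesAlgebra m) where
  carrier := {f | ∀ n, (f : A[X]).coeff n ∈ m ^ (n + 1)}
  add_mem' := by
    intro f g hf hg n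
    simpa using Ideal.add_mem _ (hf n) (hg n)
  zero_mem' := by intro n; simp
  smul_mem' := by
    intro c f hf n
    simp only [smul_eq_mul, MulMemClass.coe_mul, coeff_mul]
    refine Ideal.sum_mem _ fun p hp => ?_
    have e : p.1 + p.2 = n := by simpa using hp
    rw [← e, add_assoc, pow_add]
    exact Ideal.mul_mem_mul (c.2 p.1) (hf p.2)

open Polynomial in
theorem exists_degree_one {A : Type*} [CommRing A] [IsNoetherianRing A] [IsLocalRing A]
    [Infinite (ResidueField A)]
    (hdepth : ∃ d : ℕ, 1 ≤ d ∧ ∃ x ∈ maximalIdeal A ^ d,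
      ∀ n : ℕ, ∀ w ∈ maximalIdeal A ^ n,
        x * w ∈ maximalIdeal A ^ (n + d + 1) → w ∈ maximalIdeal A ^ (n + 1)) :
    ∃ x ∈ maximalIdeal A, ∀ n : ℕ, ∀ w ∈ maximalIdeal A ^ n,
        x * w ∈ maximalIdeal A ^ (n + 2) → w ∈ maximalIdeal A ^ (n + 1) := by
  obtain ⟨d, hd, x, hx, hreg⟩ := hdepth
  set m := maximalIdeal A with hm
  let K := grKer m
  let mon : ∀ n : ℕ, ∀ a ∈ m ^ n, reesAlgebra m := fun n a ha =>
    ⟨monomial n a, reesAlgebra.monomial_mem.mpr ha⟩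
  have hfin : (associatedPrimes (reesAlgebra m) (reesAlgebra m ⧸ K)).Finite :=
    associatedPrimes.finite _ _
  have hunion := biUnion_associatedPrimes_eq_zero_divisors (reesAlgebra m) (reesAlgebra m ⧸ K)
  let φ : m →ₗ[A] reesAlgebra m :=
    { toFun := fun a => mon 1 a (by simpa using a.2)
      map_add' := by intro a b; apply Subtype.ext; simp [mon]
      map_smul' := by intro a b; apply Subtype.ext; simp [mon, smul_monomial] }
  let V : Ideal (reesAlgebra m) → Submodule A m := fun P =>
    Submodule.comap φ (P.restrictScalars A)
  have hmemV : ∀ P y, y ∈ V P ↔ φ y ∈ P := fun P y => Iff.rfl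
  obtain ⟨y, hy⟩ := avoid hfin.toFinset V (by
    intro P hP a ha y
    rw [Set.Finite.mem_toFinset] at hP
    rw [hmemV]
    apply IsAssociatedPrime.annihilator_le hP
    rw [Submodule.mem_annihilator]
    intro q _
    obtain ⟨q, rfl⟩ := Submodule.mkQ_surjective _ q
    rw [← map_smul, Submodule.mkQ_apply, Submodule.Quotient.mk_eq_zero, smul_eq_mul]
    apply Ideal.mul_mem_right
    intro n
    change (monomial 1 ((a • y : m) : A)).coeff n ∈ _
    rw [coeff_monomial]
    split_ifs with h
    · subst h
      rw [pow_two]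
      exact Ideal.mul_mem_mul ha y.2
    · simp) (by
    intro P hP htop
    rw [Set.Finite.mem_toFinset] at hP
    have hprime : P.IsPrime := IsAssociatedPrime.isPrime hP
    have hall : ∀ n : ℕ, 1 ≤ n → ∀ a (ha : a ∈ m ^ n), mon n a ha ∈ P := by
      intro n hn
      induction n, hn using Nat.le_induction with
      | base =>
        intro a ha
        have h1 : (⟨a, by simpa using ha⟩ : m) ∈ V P := htop ▸ Submodule.mem_top
        exact h1
      | succ n hn ih =>
        intro a ha
        have ha' : a ∈ m ^ n * m := by rwa [← pow_succ]
        have : ∃ h : a ∈ m ^ (n + 1), mon (n + 1) a h ∈ P := by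
          clear ha
          induction ha' using Submodule.mul_induction_on' with
          | mem_mul_mem b hb c hc =>
            have hbc : b * c ∈ m ^ (n + 1) := by
              rw [pow_succ]; exact Ideal.mul_mem_mul hb hc
            refine ⟨hbc, ?_⟩
            have e : mon (n + 1) (b * c) hbc = mon n b hb * mon 1 c (by simpa using hc) := by
              apply Subtype.ext
              simp [mon, monomial_mul_monomial]
            rw [e]
            exact Ideal.mul_mem_right _ _ (ih b hb)
          | add b _ c _ hb hc =>
            obtain ⟨hb1, hb2⟩ := hb
            obtain ⟨hc1, hc2⟩ := hc
            refine ⟨Ideal.add_mem _ hb1 hc1, ?_⟩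
            have e : mon (n + 1) (b + c) (Ideal.add_mem _ hb1 hc1) =
                mon (n + 1) b hb1 + mon (n + 1) c hc1 := by
              apply Subtype.ext
              simp [mon]
            rw [e]
            exact Ideal.add_mem _ hb2 hc2
        exact this.2
    have hxP := hall d hd x hx
    have hz := hunion.subset (Set.mem_iUnion₂_of_mem hP hxP)
    obtain ⟨q, hq, hxq⟩ := hz
    obtain ⟨q, rfl⟩ := Submodule.mkQ_surjective _ q
    apply hq
    replace hxq : Submodule.mkQ K (mon d x hx * q) = 0 := hxq
    rw [Submodule.mkQ_apply, Submodule.Quotient.mk_eq_zero] at hxq ⊢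
    intro n
    refine hreg n _ (q.2 n) ?_
    have h2 : (monomial d x * (q : A[X])).coeff (n + d) ∈ m ^ (n + d + 1) := hxq (n + d)
    rwa [coeff_monomial_mul] at h2)
  refine ⟨y, y.2, ?_⟩
  intro n w hw hxw
  by_contra hcon
  have hz : φ y ∈ ⋃ p ∈ associatedPrimes (reesAlgebra m) (reesAlgebra m ⧸ K),
      (p : Set (reesAlgebra m)) := by
    rw [hunion]
    refine ⟨Submodule.mkQ K (mon n w hw), ?_, ?_⟩
    · rw [Submodule.mkQ_apply, Ne, Submodule.Quotient.mk_eq_zero]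
      intro h
      apply hcon
      have h2 : (monomial n w).coeff n ∈ m ^ (n + 1) := h n
      simpa using h2
    · rw [← map_smul, Submodule.mkQ_apply, Submodule.Quotient.mk_eq_zero]
      intro k
      change (monomial 1 (y : A) * monomial n w).coeff k ∈ _
      rw [monomial_mul_monomial, coeff_monomial]
      split_ifs with h
      · subst h
        have e : 1 + n + 1 = n + 2 := by ring
        rwa [e]
      · simp
  simp only [Set.mem_iUnion] at hz
  obtain ⟨P, hP, hyP⟩ := hz
  exact hy P (hfin.mem_toFinset.mpr hP) hyP

/-- If the associated graded ring `G = ⊕ m^n/m^{n+1}` has positive depth, i.e. some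
homogeneous element `x* ∈ G_d` (`d ≥ 1`) is a nonzerodivisor on `G`, then every power
`m^ℓ` has the Rees property. -/
theorem stmt9 {A : Type*} [CommRing A] [IsNoetherianRing A] [IsLocalRing A]
    [Infinite (ResidueField A)]
    (hdim : 1 ≤ ringKrullDim A)
    (hdepth : ∃ d : ℕ, 1 ≤ d ∧ ∃ x ∈ maximalIdeal A ^ d,
      ∀ n : ℕ, ∀ w ∈ maximalIdeal A ^ n,
        x * w ∈ maximalIdeal A ^ (n + d + 1) → w ∈ maximalIdeal A ^ (n + 1)) :
    ∀ ℓ : ℕ, 1 ≤ ℓ → ∀ J : Ideal A, maximalIdeal A ^ ℓ ≤ J →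
      mu J ≤ mu (maximalIdeal A ^ ℓ) := by
  intro ℓ _ J hJ
  obtain ⟨x, hx, hreg⟩ := exists_degree_one hdepth
  refine rees_of_full _ J hJ x hx (length_pow_ne_top ℓ) ?_
  intro w hw
  rw [← pow_succ'] at hw
  have : ∀ n, n ≤ ℓ → w ∈ maximalIdeal A ^ n := by
    intro n
    induction n with
    | zero => intro _; simp
    | succ n ih =>
      intro hn
      exact hreg n w (ih (by omega)) (Ideal.pow_le_pow_right (by omega) hw)
  exact this ℓ le_rfl
end
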